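/- A subgroup H of pei(S) (for S an orthohedral set) is finite if and only if the support of H is a union of a finite set Λ of pairwise disjoint orthants on which H acts faithfully by isometries on and between the members of Λ. -/

import Mathlib

open Pointwise

namespace PeiPaper

/-- Points of the face of the standard orthant spanned by the canonical basis vectors in `Y`. -/
def stdFace (N : ℕ) (Y : Finset (Fin N)) : Set (Fin N → ℤ) :=
  {v | (∀ i, 0 ≤ v i) ∧ ∀ i, i ∉ Y → v i = 0}

/-- Integral orthogonal matrix. -/
def IsOrthMat {N : ℕ} (A : Matrix (Fin N) (Fin N) ℤ) : Prop :=
  A * A.transpose = 1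

/-- `L` is an integral orthant of rank `k` in `ℤ^N`: an affine-orthogonal image of a
rank-`k` face of the standard orthant. -/
def IsOrthantOfRank {N : ℕ} (L : Set (Fin N → ℤ)) (k : ℕ) : Prop :=
  ∃ (a : Fin N → ℤ) (A : Matrix (Fin N) (Fin N) ℤ) (Y : Finset (Fin N)),
    IsOrthMat A ∧ Y.card = k ∧ L = (fun v => a + A.mulVec v) '' stdFace N Y

def IsOrthant {N : ℕ} (L : Set (Fin N → ℤ)) : Prop := ∃ k, IsOrthantOfRank L k

/-- `S` is orthohedral: a finite union of integral orthants. -/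
def IsOrthohedral {N : ℕ} (S : Set (Fin N → ℤ)) : Prop :=
  ∃ 𝓛 : Set (Set (Fin N → ℤ)), 𝓛.Finite ∧ (∀ L ∈ 𝓛, IsOrthant L) ∧ S = ⋃₀ 𝓛

/-- The rank of a set: the maximal rank of an orthant contained in it. -/
noncomputable def orthRank {N : ℕ} (S : Set (Fin N → ℤ)) : ℕ :=
  sSup {k | ∃ L, IsOrthantOfRank L k ∧ L ⊆ S}

/-- Commensurability: the intersection is nonempty and has the same rank as both sets. -/
def Commensurable {N : ℕ} (L L' : Set (Fin N → ℤ)) : Prop :=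
  (L ∩ L').Nonempty ∧ orthRank L = orthRank (L ∩ L') ∧ orthRank L' = orthRank (L ∩ L')

/-- The rank-`k` orthants contained in `S`. -/
def germSet {N : ℕ} (S : Set (Fin N → ℤ)) (k : ℕ) : Set (Set (Fin N → ℤ)) :=
  {L | IsOrthantOfRank L k ∧ L ⊆ S}

/-- The rank-`k` germs of `S`: commensurability classes of rank-`k` orthants of `S`. -/
def Germ {N : ℕ} (S : Set (Fin N → ℤ)) (k : ℕ) : Type _ :=
  Quot (fun L L' : germSet S k => Commensurable L.1 L'.1)

def germOf {N : ℕ} (S : Set (Fin N → ℤ)) (k : ℕ) (L : germSet S k) : Germ S k :=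
  Quot.mk _ L

/-- The number of rank-`k` germs of `S` (as a natural number; `0` if infinite). -/
noncomputable def heightAt {N : ℕ} (S : Set (Fin N → ℤ)) (k : ℕ) : ℕ :=
  Nat.card (Germ S k)

/-- The height of an orthohedral set: the number of germs of maximal rank. -/
noncomputable def height {N : ℕ} (S : Set (Fin N → ℤ)) : ℕ :=
  heightAt S (orthRank S)

/-- `f` is (the restriction of) an isometry of `ℤ^N` on `L`. -/
def IsometricOn {N : ℕ} (f : (Fin N → ℤ) → (Fin N → ℤ)) (L : Set (Fin N → ℤ)) : Prop :=
  ∃ (a : Fin N → ℤ) (A : Matrix (Fin N) (Fin N) ℤ),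
    IsOrthMat A ∧ ∀ x ∈ L, f x = a + A.mulVec x

/-- `f` is (the restriction of) a translation on `L`. -/
def TranslationOn {N : ℕ} (f : (Fin N → ℤ) → (Fin N → ℤ)) (L : Set (Fin N → ℤ)) : Prop :=
  ∃ a : Fin N → ℤ, ∀ x ∈ L, f x = a + x

/-- `f` is a piecewise-Euclidean-isometric map on `S`. -/
def IsPeiMapOn {N : ℕ} (S : Set (Fin N → ℤ)) (f : (Fin N → ℤ) → (Fin N → ℤ)) : Prop :=
  ∃ 𝓛 : Set (Set (Fin N → ℤ)), 𝓛.Finite ∧ (∀ L ∈ 𝓛, IsOrthant L) ∧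
    S = ⋃₀ 𝓛 ∧ 𝓛.PairwiseDisjoint id ∧ ∀ L ∈ 𝓛, IsometricOn f L

/-- `f` is a piecewise-Euclidean-translation map on `S`. -/
def IsPetMapOn {N : ℕ} (S : Set (Fin N → ℤ)) (f : (Fin N → ℤ) → (Fin N → ℤ)) : Prop :=
  ∃ 𝓛 : Set (Set (Fin N → ℤ)), 𝓛.Finite ∧ (∀ L ∈ 𝓛, IsOrthant L) ∧
    S = ⋃₀ 𝓛 ∧ 𝓛.PairwiseDisjoint id ∧ ∀ L ∈ 𝓛, TranslationOn f L

def IsPeiIso {N : ℕ} (S S' : Set (Fin N → ℤ)) (f : (Fin N → ℤ) → (Fin N → ℤ)) : Prop :=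
  IsPeiMapOn S f ∧ Set.InjOn f S ∧ f '' S = S'

def PeiIsomorphic {N : ℕ} (S S' : Set (Fin N → ℤ)) : Prop := ∃ f, IsPeiIso S S' f

def IsPetIso {N : ℕ} (S S' : Set (Fin N → ℤ)) (f : (Fin N → ℤ) → (Fin N → ℤ)) : Prop :=
  IsPetMapOn S f ∧ Set.InjOn f S ∧ f '' S = S'

def PetIsomorphic {N : ℕ} (S S' : Set (Fin N → ℤ)) : Prop := ∃ f, IsPetIso S S' f

/-- A pei-permutation of `S`: a permutation of `ℤ^N` supported on `S` which is pei on `S`. -/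
def IsPeiPerm {N : ℕ} (S : Set (Fin N → ℤ)) (g : Equiv.Perm (Fin N → ℤ)) : Prop :=
  IsPeiMapOn S ⇑g ∧ ∀ x ∉ S, g x = x

/-- The element `g` has rank at most `k`: it is supported on an orthohedral set of rank `≤ k`. -/
def rankLE {N : ℕ} (g : Equiv.Perm (Fin N → ℤ)) (k : ℕ) : Prop :=
  ∃ T : Set (Fin N → ℤ), IsOrthohedral T ∧ orthRank T ≤ k ∧ ∀ x ∉ T, g x = x

/-- `g` fixes every rank-`k` germ of `S`. -/
def FixesGerm {N : ℕ} (S : Set (Fin N → ℤ)) (k : ℕ) (g : Equiv.Perm (Fin N → ℤ)) : Prop :=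
  ∀ L, IsOrthantOfRank L k → L ⊆ S →
    ∃ L', IsOrthantOfRank L' k ∧ L' ⊆ L ∧ Commensurable L L' ∧
      IsometricOn (⇑g) L' ∧ Commensurable (⇑g '' L') L

/-- `g` fixes every rank-`k` germ of `S` and acts on its tangent coset by a translation. -/
def TranslatesGerm {N : ℕ} (S : Set (Fin N → ℤ)) (k : ℕ) (g : Equiv.Perm (Fin N → ℤ)) : Prop :=
  ∀ L, IsOrthantOfRank L k → L ⊆ S →
    ∃ L' a, IsOrthantOfRank L' k ∧ L' ⊆ L ∧ Commensurable L L' ∧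
      (∀ x ∈ L', g x = a + x) ∧ Commensurable (⇑g '' L') L

/-- `σ` is the map induced by `g` on the rank-`k` germs of `S`. -/
def InducesGermMap {N : ℕ} (S : Set (Fin N → ℤ)) (k : ℕ) (g : Equiv.Perm (Fin N → ℤ))
    (σ : Germ S k → Germ S k) : Prop :=
  ∀ L : germSet S k, ∃ (L'' : Set (Fin N → ℤ)) (M : germSet S k),
    IsOrthantOfRank L'' k ∧ L'' ⊆ L.1 ∧ Commensurable L.1 L'' ∧
    M.1 = ⇑g '' L'' ∧ σ (germOf S k L) = germOf S k M

/-- A finitary permutation which is even (has sign `1` on a finite invariant subset). -/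
def IsEvenFinitary {α : Type*} (σ : Equiv.Perm α) : Prop :=
  ∃ (F : Finset α) (σF : Equiv.Perm F),
    (∀ a ∉ F, σ a = a) ∧ (∀ a : F, σ (a : α) = (σF a : α)) ∧
    @Equiv.Perm.sign F (Classical.decEq _) inferInstance σF = 1

/-- `g` induces an even finitary permutation on the rank-`k` germs of `S`. -/
def IsEvenOnGerms {N : ℕ} (S : Set (Fin N → ℤ)) (k : ℕ) (g : Equiv.Perm (Fin N → ℤ)) : Prop :=
  ∃ σ : Equiv.Perm (Germ S k), InducesGermMap S k g ⇑σ ∧ IsEvenFinitary σ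

/-- Ordering of germs (of arbitrary ranks): `p ≤ q` if they have representatives `L ⊆ L'`. -/
def germLE {N : ℕ} (S : Set (Fin N → ℤ)) (p q : Σ k, Germ S k) : Prop :=
  ∃ (L : germSet S p.1) (L' : germSet S q.1),
    germOf S p.1 L = p.2 ∧ germOf S q.1 L' = q.2 ∧ L.1 ⊆ L'.1

/-- A maximal germ of `S`. -/
def IsMaxGerm {N : ℕ} (S : Set (Fin N → ℤ)) (p : Σ k, Germ S k) : Prop :=
  ∀ q, germLE S p q → germLE S q p

/-- A `0`-based orthant. -/
def IsBasedOrthant {N : ℕ} (L0 : Set (Fin N → ℤ)) : Prop :=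
  ∃ (A : Matrix (Fin N) (Fin N) ℤ) (Y : Finset (Fin N)),
    IsOrthMat A ∧ L0 = (fun v => A.mulVec v) '' stdFace N Y

/-- Two (oriented) parallel orthants. -/
def ParallelOrthants {N : ℕ} (L L' : Set (Fin N → ℤ)) : Prop :=
  ∃ a : Fin N → ℤ, L' = a +ᵥ L

/-- The indicator image `S_τ` of `S`: the union of the `0`-based parallel translates of
the orthants contained in `S`. -/
def indicatorImage {N : ℕ} (S : Set (Fin N → ℤ)) : Set (Fin N → ℤ) :=
  ⋃₀ {L0 | IsBasedOrthant L0 ∧ ∃ a : Fin N → ℤ, (a +ᵥ L0) ⊆ S}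

/-- The height function `h_S`: the number of maximal germs of `S` whose indicator is `L0`. -/
noncomputable def hFun {N : ℕ} (S : Set (Fin N → ℤ)) (L0 : Set (Fin N → ℤ)) : ℕ :=
  Nat.card {p : Σ k, Germ S k //
    IsMaxGerm S p ∧ ∃ L : germSet S p.1, germOf S p.1 L = p.2 ∧ ∃ a : Fin N → ℤ, L.1 = a +ᵥ L0}

/-- `S` is quasi-normal: the maximal based orthants of `S_τ` are exactly the support of `h_S`. -/
def QuasiNormal {N : ℕ} (S : Set (Fin N → ℤ)) : Prop :=
  ∀ L0 : Set (Fin N → ℤ),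
    (IsBasedOrthant L0 ∧ L0 ⊆ indicatorImage S ∧
      ∀ L1, IsBasedOrthant L1 → L1 ⊆ indicatorImage S → L0 ⊆ L1 → L1 ⊆ L0)
    ↔ (IsBasedOrthant L0 ∧ 0 < hFun S L0)

/-- The germ `q` of `S'` is the image of the germ `p` of `S` under the injective pei-map `f`. -/
def GermMapsTo {N : ℕ} (f : (Fin N → ℤ) → (Fin N → ℤ)) (S S' : Set (Fin N → ℤ))
    (p : Σ k, Germ S k) (q : Σ k, Germ S' k) : Prop :=
  p.1 = q.1 ∧ ∃ (L : germSet S p.1) (L'' : Set (Fin N → ℤ)) (M : germSet S' q.1),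
    germOf S p.1 L = p.2 ∧ IsOrthantOfRank L'' p.1 ∧ L'' ⊆ L.1 ∧ Commensurable L.1 L'' ∧
    M.1 = f '' L'' ∧ germOf S' q.1 M = q.2

/-- A stack of `h` parallel rank-`n` orthants. -/
def IsStack {N : ℕ} (S : Set (Fin N → ℤ)) (n h : ℕ) : Prop :=
  ∃ (L0 : Set (Fin N → ℤ)) (a : Fin h → (Fin N → ℤ)),
    IsOrthantOfRank L0 n ∧
    (Pairwise fun i j => Disjoint (a i +ᵥ L0) (a j +ᵥ L0)) ∧
    S = ⋃ i, a i +ᵥ L0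

/-- A coordinate half-space of `ℤ^N`. -/
def IsHalfSpace {N : ℕ} (H : Set (Fin N → ℤ)) : Prop :=
  ∃ (i : Fin N) (c : ℤ), H = {x | x i ≤ c} ∨ H = {x | c ≤ x i}

/-- The canonical embedding `ℤ^N → ℤ^{N+1}`. -/
def emb (N : ℕ) (x : Fin N → ℤ) : Fin (N + 1) → ℤ :=
  fun i => if h : (i : ℕ) < N then x ⟨i, h⟩ else 0

/-- The sum of all matrix entries of a finitely supported family of vectors. -/
noncomputable def totalSum (k : ℕ) (Γ : Type*) : (Γ →₀ (Fin k → ℤ)) →+ ℤ :=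
  Finsupp.liftAddHom (fun _ => ∑ i : Fin k, Pi.evalAddMonoidHom (fun _ => ℤ) i)

/-- The clique (flag) complex of a graph. -/
def cliqueComplex {V : Type*} (G : SimpleGraph V) : Set (Finset V) :=
  {s | s.Nonempty ∧ G.IsClique (s : Set V)}

/-- The geometric realization of a simplicial complex on vertex set `V`. -/
def realization {V : Type*} (K : Set (Finset V)) : Set (V → ℝ) :=
  {f | (∀ v, 0 ≤ f v) ∧ ∃ s ∈ K, Function.support f ⊆ ↑s ∧ ∑ v ∈ s, f v = 1}

/-- A wedge (bouquet) of `n`-spheres indexed by `ι`, with basepoint `b`. -/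
noncomputable def wedgeSpheres (ι : Type) (n : ℕ)
    (b : Metric.sphere (0 : EuclideanSpace ℝ (Fin (n + 1))) 1) : Type :=
  Quot (fun p q : Unit ⊕ (ι × Metric.sphere (0 : EuclideanSpace ℝ (Fin (n + 1))) 1) =>
    (Sum.elim (fun _ => True) (fun pr => pr.2 = b) p) ∧
    (Sum.elim (fun _ => True) (fun qr => qr.2 = b) q))

noncomputable instance (ι : Type) (n : ℕ) (b : Metric.sphere (0 : EuclideanSpace ℝ (Fin (n + 1))) 1) :
    TopologicalSpace (wedgeSpheres ι n b) :=
  letI : TopologicalSpace ι := ⊥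
  instTopologicalSpaceQuot


/-- An integral orthogonal matrix acts by permuting the coordinates and changing signs. -/
lemma IsOrthMat.exists_signed_perm {N : ℕ} {A : Matrix (Fin N) (Fin N) ℤ} (hA : IsOrthMat A) :
    ∃ (σ : Equiv.Perm (Fin N)) (ε : Fin N → ℤ), (∀ i, ε i = 1 ∨ ε i = -1) ∧
      ∀ v i, A.mulVec v i = ε i * v (σ i) := by
  have hdot : ∀ i j, ∑ k, A i k * A j k = if i = j then 1 else 0 := by
    intro i j
    have h := congrFun (congrFun hA i) j
    simpa [Matrix.mul_apply, Matrix.one_apply] using h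
  have hrow : ∀ i, ∃ j, (A i j = 1 ∨ A i j = -1) ∧ ∀ k, k ≠ j → A i k = 0 := by
    intro i
    have hsum : ∑ k, A i k * A i k = 1 := by simpa using hdot i i
    obtain ⟨j, hj⟩ : ∃ j, A i j ≠ 0 := by
      by_contra! h
      simp [h] at hsum
    have hsplit := Finset.add_sum_erase Finset.univ (fun k => A i k * A i k) (Finset.mem_univ j)
    have hnonneg : ∀ k ∈ Finset.univ.erase j, 0 ≤ A i k * A i k := fun k _ => mul_self_nonneg _
    have hrest := Finset.sum_nonneg hnonneg
    have hpos : 0 < A i j * A i j := mul_self_pos.mpr hj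
    simp only [hsum] at hsplit
    refine ⟨j, mul_self_eq_one_iff.mp (by omega), fun k hk => ?_⟩
    have h0 := (Finset.sum_eq_zero_iff_of_nonneg hnonneg).mp (by omega) k
      (Finset.mem_erase.mpr ⟨hk, Finset.mem_univ _⟩)
    exact mul_self_eq_zero.mp h0
  choose τ hτ hτ0 using hrow
  have hinj : Function.Injective τ := by
    intro i j hij
    by_contra hne
    have h := hdot i j
    rw [Finset.sum_eq_single (τ i) (fun k _ hk => by rw [hτ0 i k hk, zero_mul]) (by simp),
      if_neg hne] at h
    have h1 := hτ i
    have h2 := hτ j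
    rw [← hij] at h2
    rcases h1 with h1 | h1 <;> rcases h2 with h2 | h2 <;> simp [h1, h2] at h
  refine ⟨Equiv.ofBijective τ (Finite.injective_iff_bijective.mp hinj), fun i => A i (τ i), hτ, ?_⟩
  intro v i
  simp only [Matrix.mulVec, dotProduct, Equiv.ofBijective_apply]
  exact Finset.sum_eq_single (τ i) (fun k _ hk => by rw [hτ0 i k hk, zero_mul]) (by simp)

lemma IsOrthMat.transpose_mul {N : ℕ} {A : Matrix (Fin N) (Fin N) ℤ} (hA : IsOrthMat A) :
    A.transpose * A = 1 :=
  mul_eq_one_comm.mp hA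

lemma IsOrthMat.transpose {N : ℕ} {A : Matrix (Fin N) (Fin N) ℤ} (hA : IsOrthMat A) :
    IsOrthMat A.transpose := by
  simpa [IsOrthMat] using hA.transpose_mul

lemma IsOrthMat.mul {N : ℕ} {A B : Matrix (Fin N) (Fin N) ℤ} (hA : IsOrthMat A)
    (hB : IsOrthMat B) : IsOrthMat (A * B) := by
  unfold IsOrthMat at *
  rw [Matrix.transpose_mul, Matrix.mul_assoc, ← Matrix.mul_assoc B, hB, Matrix.one_mul, hA]

lemma finite_isOrthMat (N : ℕ) : {A : Matrix (Fin N) (Fin N) ℤ | IsOrthMat A}.Finite := by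
  have hfin : {A : Fin N → Fin N → ℤ |
      ∀ i, A i ∈ {r : Fin N → ℤ | ∀ j, r j ∈ Set.Icc (-1) 1}}.Finite :=
    Set.Finite.pi' fun _ => Set.Finite.pi' fun _ => Set.finite_Icc _ _
  refine hfin.subset fun (A : Matrix (Fin N) (Fin N) ℤ) hA i j => ?_
  obtain ⟨σ, ε, hε, h⟩ := IsOrthMat.exists_signed_perm hA
  have hij : A i j = ε i * (Pi.single j 1 : Fin N → ℤ) (σ i) := by
    rw [← h, Matrix.mulVec_single_one]
    rfl
  rw [hij, Set.mem_Icc]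
  by_cases hj : σ i = j
  · subst hj
    rcases hε i with h1 | h1 <;> simp [h1]
  · simp [Pi.single_eq_of_ne hj]

/-- The coordinate projections of orthants: points and half-lines of `ℤ`. -/
def IsRay (J : Set ℤ) : Prop := ∃ c, J = {c} ∨ J = Set.Ici c ∨ J = Set.Iic c

lemma IsRay.ordConnected {J : Set ℤ} (hJ : IsRay J) : J.OrdConnected := by
  obtain ⟨c, rfl | rfl | rfl⟩ := hJ
  exacts [Set.ordConnected_singleton, Set.ordConnected_Ici, Set.ordConnected_Iic]

lemma IsRay.ne_univ {J : Set ℤ} (hJ : IsRay J) : J ≠ Set.univ := by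
  obtain ⟨c, rfl | rfl | rfl⟩ := hJ <;> intro h
  · have := h.symm ▸ Set.mem_univ (c + 1)
    simp at this
  · have := h.symm ▸ Set.mem_univ (c - 1)
    simp at this
  · have := h.symm ▸ Set.mem_univ (c + 1)
    simp at this

lemma IsRay.nonempty {J : Set ℤ} (hJ : IsRay J) : J.Nonempty := by
  obtain ⟨c, rfl | rfl | rfl⟩ := hJ <;> exact ⟨c, by simp⟩

lemma IsRay.eq_of_finite {J : Set ℤ} (hJ : IsRay J) (hfin : J.Finite) {x y : ℤ} (hx : x ∈ J)
    (hy : y ∈ J) : x = y := by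
  obtain ⟨c, rfl | rfl | rfl⟩ := hJ
  · exact hx.trans hy.symm
  · exact absurd hfin (Set.Ici_infinite c)
  · exact absurd hfin (Set.Iic_infinite c)

lemma isRay_of_infinite {I : Set ℤ} (hI : I.OrdConnected) (hne : I ≠ Set.univ)
    (hinf : I.Infinite) : IsRay I := by
  by_cases hb : BddBelow I
  · have ha : ¬ BddAbove I := fun ha => hinf (hb.finite_of_bddAbove ha)
    obtain ⟨b, hb⟩ := hb
    obtain ⟨c, hc, hmin⟩ := Int.exists_least_of_bdd (P := (· ∈ I)) ⟨b, fun z hz => hb hz⟩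
      hinf.nonempty
    refine ⟨c, Or.inr (Or.inl (Set.Subset.antisymm hmin fun z hz => ?_))⟩
    obtain ⟨w, hw, hzw⟩ := not_bddAbove_iff.mp ha z
    exact hI.out hc hw ⟨hz, hzw.le⟩
  · by_cases ha : BddAbove I
    · obtain ⟨b, ha⟩ := ha
      obtain ⟨c, hc, hmax⟩ := Int.exists_greatest_of_bdd (P := (· ∈ I)) ⟨b, fun z hz => ha hz⟩
        hinf.nonempty
      refine ⟨c, Or.inr (Or.inr (Set.Subset.antisymm hmax fun z hz => ?_))⟩
      obtain ⟨w, hw, hzw⟩ := not_bddBelow_iff.mp hb z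
      exact hI.out hw hc ⟨hzw.le, hz⟩
    · refine absurd (Set.eq_univ_of_forall fun z => ?_) hne
      obtain ⟨w, hw, hzw⟩ := not_bddAbove_iff.mp ha z
      obtain ⟨u, hu, huz⟩ := not_bddBelow_iff.mp hb z
      exact hI.out hu hw ⟨huz.le, hzw.le⟩

lemma IsOrthant.exists_rays {N : ℕ} {L : Set (Fin N → ℤ)} (hL : IsOrthant L) :
    ∃ J : Fin N → Set ℤ, (∀ i, IsRay (J i)) ∧ L = Set.univ.pi J := by
  classical
  obtain ⟨k, a, A, Y, hA, -, rfl⟩ := hL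
  obtain ⟨σ, ε, hε, hmul⟩ := hA.exists_signed_perm
  refine ⟨fun i => if σ i ∈ Y then (if ε i = 1 then Set.Ici (a i) else Set.Iic (a i)) else {a i},
    fun i => ⟨a i, ?_⟩, ?_⟩
  · dsimp only
    split_ifs <;> simp
  · ext x
    simp only [Set.mem_image, Set.mem_univ_pi]
    constructor
    · rintro ⟨v, ⟨hv, hv0⟩, rfl⟩ i
      have h := hv (σ i)
      simp only [Pi.add_apply, hmul]
      split_ifs with h1 h2
      · simp [h2, h]
      · simp [(hε i).resolve_left h2, h]
      · simp [hv0 _ h1]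
    · intro hx
      refine ⟨fun j => ε (σ.symm j) * (x (σ.symm j) - a (σ.symm j)),
        ⟨fun j => ?_, fun j hj => ?_⟩, ?_⟩
      · have h := hx (σ.symm j)
        rw [Equiv.apply_symm_apply] at h
        dsimp only
        split_ifs at h with h1 h2
        · simpa [h2] using h
        · simpa [(hε _).resolve_left h2] using h
        · simp_all
      · have h := hx (σ.symm j)
        rw [Equiv.apply_symm_apply, if_neg hj, Set.mem_singleton_iff] at h
        simp [h]
      · funext i
        simp only [Pi.add_apply, hmul, Equiv.symm_apply_apply]
        rcases hε i with h | h <;> simp [h]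

lemma isOrthant_pi {N : ℕ} {J : Fin N → Set ℤ} (hJ : ∀ i, IsRay (J i)) :
    IsOrthant (Set.univ.pi J) := by
  classical
  have hray : ∀ i, ∃ (c ε : ℤ) (p : Prop), (ε = 1 ∨ ε = -1) ∧
      ∀ t, t ∈ J i ↔ 0 ≤ ε * (t - c) ∧ (¬ p → t = c) := by
    intro i
    obtain ⟨c, h | h | h⟩ := hJ i
    · exact ⟨c, 1, False, Or.inl rfl, fun t => by simp +contextual [h]⟩
    · exact ⟨c, 1, True, Or.inl rfl, fun t => by simp [h]⟩
    · exact ⟨c, -1, True, Or.inr rfl, fun t => by simp [h]⟩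
  choose c ε p hε hJ using hray
  have hsq : ∀ i, ε i * ε i = 1 := fun i => by rcases hε i with h | h <;> simp [h]
  refine ⟨_, c, Matrix.diagonal ε, Finset.univ.filter p, ?_, rfl, ?_⟩
  · simp [IsOrthMat, Matrix.diagonal_mul_diagonal, hsq]
  · ext x
    simp only [Set.mem_image, Set.mem_univ_pi, hJ]
    constructor
    · intro hx
      refine ⟨fun i => ε i * (x i - c i), ⟨fun i => (hx i).1, fun i hi => ?_⟩, ?_⟩
      · simp [(hx i).2 (by simpa using hi)]
      · funext i
        simp [Matrix.mulVec_diagonal, ← mul_assoc, hsq]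
    · rintro ⟨v, ⟨hv, hv0⟩, rfl⟩ i
      refine ⟨?_, fun hi => ?_⟩
      · simpa [Matrix.mulVec_diagonal, ← mul_assoc, hsq] using hv i
      · simp [Matrix.mulVec_diagonal, hv0 i (by simpa using hi)]

lemma IsOrthant.nonempty {N : ℕ} {L : Set (Fin N → ℤ)} (hL : IsOrthant L) : L.Nonempty := by
  obtain ⟨J, hJ, rfl⟩ := hL.exists_rays
  exact Set.univ_pi_nonempty_iff.mpr fun i => (hJ i).nonempty

lemma IsOrthant.image {N : ℕ} {L : Set (Fin N → ℤ)} (hL : IsOrthant L) (b : Fin N → ℤ)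
    {B : Matrix (Fin N) (Fin N) ℤ} (hB : IsOrthMat B) :
    IsOrthant ((fun x => b + B.mulVec x) '' L) := by
  obtain ⟨k, a, A, Y, hA, hY, rfl⟩ := hL
  refine ⟨k, b + B.mulVec a, B * A, Y, hB.mul hA, hY, ?_⟩
  rw [Set.image_image]
  refine Set.image_congr fun v _ => ?_
  simp [Matrix.mulVec_add, add_assoc]

lemma IsOrthant.preimage {N : ℕ} {L : Set (Fin N → ℤ)} (hL : IsOrthant L) (b : Fin N → ℤ)
    {B : Matrix (Fin N) (Fin N) ℤ} (hB : IsOrthMat B) :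
    IsOrthant ((fun x => b + B.mulVec x) ⁻¹' L) := by
  have h := hL.image (-(B.transpose.mulVec b)) hB.transpose
  rwa [Set.image_eq_preimage_of_inverse (g := fun x => b + B.mulVec x)] at h
  · intro x
    simp [Matrix.mulVec_add, Matrix.mulVec_neg, show B * B.transpose = 1 from hB]
  · intro x
    simp [Matrix.mulVec_add, hB.transpose_mul]

lemma IsometricOn.mono {N : ℕ} {f : (Fin N → ℤ) → (Fin N → ℤ)} {L M : Set (Fin N → ℤ)}
    (hf : IsometricOn f M) (h : L ⊆ M) : IsometricOn f L := by
  obtain ⟨a, A, hA, hf⟩ := hf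
  exact ⟨a, A, hA, fun x hx => hf x (h hx)⟩

lemma IsometricOn.isOrthant_image {N : ℕ} {f : (Fin N → ℤ) → (Fin N → ℤ)} {L : Set (Fin N → ℤ)}
    (hf : IsometricOn f L) (hL : IsOrthant L) : IsOrthant (f '' L) := by
  obtain ⟨a, A, hA, hf⟩ := hf
  rw [Set.image_congr hf]
  exact hL.image a hA

/-- The only translation preserving an orthant is the identity. -/
lemma IsOrthant.eq_of_image_eq {N : ℕ} {L : Set (Fin N → ℤ)} (hL : IsOrthant L)
    {a b : Fin N → ℤ} {T : Set (Fin N → ℤ)} (h : (a + ·) '' T = L) (h' : (b + ·) '' T = L) :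
    a = b := by
  obtain ⟨k, c, A, Y, hA, -, rfl⟩ := hL
  have hzero : (0 : Fin N → ℤ) ∈ stdFace N Y := ⟨fun _ => le_rfl, fun _ _ => rfl⟩
  have key : ∀ {a b : Fin N → ℤ}, (a + ·) '' T = (fun v => c + A.mulVec v) '' stdFace N Y →
      (b + ·) '' T = (fun v => c + A.mulVec v) '' stdFace N Y →
      ∀ i, 0 ≤ A.transpose.mulVec (b - a) i := by
    intro a b h h' i
    obtain ⟨t, ht, hct⟩ := h.symm ▸ Set.mem_image_of_mem (fun v => c + A.mulVec v) hzero
    obtain ⟨v, hv, hcv⟩ := h' ▸ Set.mem_image_of_mem (b + ·) ht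
    have hsub : b - a = A.mulVec v := by
      funext j
      have h1 := congrFun hct j
      have h2 := congrFun hcv j
      simp only [Pi.add_apply, Matrix.mulVec_zero, Pi.zero_apply, Pi.sub_apply] at h1 h2 ⊢
      omega
    rw [hsub, Matrix.mulVec_mulVec, hA.transpose_mul, Matrix.one_mulVec]
    exact hv.1 i
  have hdiff : A.transpose.mulVec (b - a) = 0 := by
    funext i
    have h1 := key h h' i
    have h2 := key h' h i
    rw [← neg_sub b a, Matrix.mulVec_neg, Pi.neg_apply] at h2
    exact le_antisymm (neg_nonneg.mp h2) h1
  have h0 := congrArg A.mulVec hdiff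
  rw [Matrix.mulVec_mulVec, show A * A.transpose = 1 from hA, Matrix.one_mulVec,
    Matrix.mulVec_zero] at h0
  exact (sub_eq_zero.mp h0).symm

/-- Products of order-connected proper subsets of `ℤ`. -/
def IsBox {N : ℕ} (Q : Set (Fin N → ℤ)) : Prop :=
  ∃ I : Fin N → Set ℤ, (∀ i, (I i).OrdConnected ∧ I i ≠ Set.univ) ∧ Q = Set.univ.pi I

lemma isBox_iInter {N : ℕ} {ι : Type*} [Nonempty ι] {L : ι → Set (Fin N → ℤ)}
    (hL : ∀ t, IsOrthant (L t)) : IsBox (⋂ t, L t) := by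
  choose J hJ hLJ using fun t => (hL t).exists_rays
  refine ⟨fun i => ⋂ t, J t i, fun i => ⟨Set.ordConnected_iInter fun t => (hJ t i).ordConnected,
    fun h => ?_⟩, ?_⟩
  · obtain ⟨t⟩ := ‹Nonempty ι›
    exact (hJ t i).ne_univ (Set.iInter_eq_univ.mp h t)
  · ext x
    simp only [Set.mem_iInter, hLJ, Set.mem_univ_pi]
    exact forall_comm

/-- The orthants contained in `Q` that are maximal with respect to inclusion. -/
def maxOrthants {N : ℕ} (Q : Set (Fin N → ℤ)) : Set (Set (Fin N → ℤ)) :=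
  {L | Maximal (fun L => IsOrthant L ∧ L ⊆ Q) L}

/-- A box is the disjoint union of its finitely many maximal orthants. -/
lemma IsBox.maxOrthants_partition {N : ℕ} {Q : Set (Fin N → ℤ)} (hQ : IsBox Q) :
    (maxOrthants Q).Finite ∧ (∀ x ∈ Q, ∃ L ∈ maxOrthants Q, x ∈ L) ∧
      ∀ L ∈ maxOrthants Q, ∀ L' ∈ maxOrthants Q, ∀ x, x ∈ L → x ∈ L' → L = L' := by
  classical
  obtain ⟨I, hI, rfl⟩ := hQ
  let J : (Fin N → ℤ) → Fin N → Set ℤ := fun x i => if (I i).Finite then {x i} else I i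
  let M : (Fin N → ℤ) → Set (Fin N → ℤ) := fun x => Set.univ.pi (J x)
  have hself : ∀ x ∈ Set.univ.pi I, x ∈ M x := by
    intro x hx i _
    dsimp only [J]
    split_ifs
    exacts [rfl, hx i trivial]
  have hM : ∀ x, IsOrthant (M x) := by
    intro x
    refine isOrthant_pi fun i => ?_
    dsimp only [J]
    split_ifs with h
    exacts [⟨_, Or.inl rfl⟩, isRay_of_infinite (hI i).1 (hI i).2 h]
  have hMsub : ∀ x ∈ Set.univ.pi I, M x ⊆ Set.univ.pi I := by
    intro x hx y hy i _
    have h := hy i trivial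
    dsimp only [J] at h
    split_ifs at h
    · rw [Set.mem_singleton_iff.mp h]
      exact hx i trivial
    · exact h
  have hsub : ∀ L, IsOrthant L → L ⊆ Set.univ.pi I → ∀ x ∈ L, L ⊆ M x := by
    intro L hL hLI x hx y hy i _
    dsimp only [J]
    split_ifs with h
    · obtain ⟨K, hK, rfl⟩ := hL.exists_rays
      refine (hK i).eq_of_finite (h.subset fun t ht => ?_) (hy i trivial) (hx i trivial)
      have hmem : Function.update x i t ∈ Set.univ.pi K := by
        intro j _
        by_cases hj : j = i
        · subst hj
          simpa using ht
        · simpa [Function.update_of_ne hj] using hx j trivial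
      simpa using hLI hmem i trivial
    · exact hLI hy i trivial
  have heq : ∀ L ∈ maxOrthants (Set.univ.pi I), ∀ x ∈ L, L = M x := by
    intro L hL x hx
    have h := hsub L hL.1.1 hL.1.2 x hx
    exact h.antisymm (hL.2 ⟨hM x, hMsub x (hL.1.2 hx)⟩ h)
  refine ⟨?_, fun x hx => ⟨M x, ⟨⟨hM x, hMsub x hx⟩, fun L hL hxL => ?_⟩, hself x hx⟩, ?_⟩
  · have hfin : (Set.univ.pi fun i => if (I i).Finite then I i else {0}).Finite := by
      refine Set.Finite.pi' (t := fun i => if (I i).Finite then I i else {0}) ?_ |>.subset ?_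
      · intro i
        split_ifs with h
        exacts [h, Set.finite_singleton 0]
      · exact fun x hx i => hx i trivial
    refine (hfin.image M).subset fun L hL => ?_
    obtain ⟨x, hx⟩ := hL.1.1.nonempty
    refine ⟨fun i => if (I i).Finite then x i else 0, fun i _ => ?_, ?_⟩
    · dsimp only
      split_ifs
      exacts [hL.1.2 hx i trivial, rfl]
    · rw [heq L hL x hx]
      refine congrArg (Set.univ.pi) (funext fun i => ?_)
      dsimp only [J]
      split_ifs <;> rfl
  · exact hsub L hL.1 hL.2 x (hxL (hself x hx))
  · intro L hL L' hL' x hx hx'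
    rw [heq L hL x hx, heq L' hL' x hx']

lemma image_mem_maxOrthants {N : ℕ} {Q : Set (Fin N → ℤ)} {g : Equiv.Perm (Fin N → ℤ)}
    (hg : IsometricOn g Q) (hg' : IsometricOn g.symm (g '' Q)) {L : Set (Fin N → ℤ)}
    (hL : L ∈ maxOrthants Q) : g '' L ∈ maxOrthants (g '' Q) := by
  refine ⟨⟨(hg.mono hL.1.2).isOrthant_image hL.1.1, Set.image_mono hL.1.2⟩, fun K hK hLK => ?_⟩
  have h := hL.2 (y := g.symm '' K) ⟨(hg'.mono hK.2).isOrthant_image hK.1, ?_⟩ ?_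
  · simpa [Set.image_image] using Set.image_mono (f := g) h
  · simpa [Set.image_image] using Set.image_mono (f := g.symm) hK.2
  · simpa [Set.image_image] using Set.image_mono (f := g.symm) hLK

lemma mem_of_fixes_compl {α : Type*} {S : Set α} {g : Equiv.Perm α} (hg : ∀ x ∉ S, g x = x) {x : α}
    (hx : x ∈ S) : g x ∈ S := by
  by_contra h
  exact h ((g.injective (hg _ h)).symm ▸ hx)

/-- A finite subgroup of `pei(S)` preserves a finite partition of `S` into orthants on which it
acts by isometries. -/
lemma exists_invariant_partition {N : ℕ} {S : Set (Fin N → ℤ)}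
    {H : Subgroup (Equiv.Perm (Fin N → ℤ))} (hH : ∀ g ∈ H, IsPeiPerm S g) [Finite H] :
    ∃ Λ : Set (Set (Fin N → ℤ)), Λ.Finite ∧ (∀ L ∈ Λ, IsOrthant L) ∧
      Λ.PairwiseDisjoint id ∧ ⋃₀ Λ = S ∧
      ∀ g ∈ H, ∀ L ∈ Λ, IsometricOn g L ∧ g '' L ∈ Λ := by
  choose P hPfin hPorth hPS hPdisj hPiso using fun g : H => (hH g g.2).1
  have hgS : ∀ (g : H) {x}, x ∈ S → (g : Equiv.Perm _) x ∈ S :=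
    fun g x => mem_of_fixes_compl (hH g g.2).2
  have : ∀ g, Finite (P g) := fun g => (hPfin g).to_subtype
  let sig : (Fin N → ℤ) → Set (H × Σ h : H, P h) := fun x => {t | (t.1 : Equiv.Perm _) x ∈ t.2.2.1}
  let Q : (Fin N → ℤ) → Set (Fin N → ℤ) := fun x => {y | sig y = sig x}
  have hpiece : ∀ h : H, ∀ x ∈ S, ∃ L : P h, x ∈ L.1 := by
    intro h x hx
    rw [hPS h] at hx
    obtain ⟨L, hL, hxL⟩ := hx
    exact ⟨⟨L, hL⟩, hxL⟩
  choose p hp using hpiece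
  have hmem : ∀ x (hx : x ∈ S) y, y ∈ Q x ↔ ∀ g h : H,
      (g : Equiv.Perm _) y ∈ (p h ((g : Equiv.Perm _) x) (hgS g hx)).1 := by
    intro x hx y
    constructor
    · intro hy g h
      have hxt : (g, ⟨h, p h _ (hgS g hx)⟩) ∈ sig x := hp h _ (hgS g hx)
      rw [← show sig y = sig x from hy] at hxt
      exact hxt
    · intro hy
      ext ⟨g, h, L, hL⟩
      change (g : Equiv.Perm _) y ∈ L ↔ (g : Equiv.Perm _) x ∈ L
      have hyL := hy g h
      have hxL := hp h _ (hgS g hx)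
      generalize p h _ (hgS g hx) = K at hyL hxL
      obtain ⟨K, hK⟩ := K
      constructor
      · intro h1
        rwa [(hPdisj h).elim_set hL hK _ h1 hyL]
      · intro h1
        rwa [(hPdisj h).elim_set hL hK _ h1 hxL]
  have hQsub : ∀ (h : H) x (hx : x ∈ S), Q x ⊆ (p h x hx).1 := by
    intro h x hx y hy
    simpa using (hmem x hx y).mp hy 1 h
  have hQiso : ∀ (h : H), ∀ x ∈ S, IsometricOn (h : Equiv.Perm _) (Q x) := fun h x hx =>
    (hPiso h _ (p h x hx).2).mono (hQsub h x hx)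
  have hQS : ∀ x ∈ S, Q x ⊆ S := fun x hx y hy => by
    rw [hPS 1]
    exact ⟨_, (p 1 x hx).2, hQsub 1 x hx hy⟩
  have hQbox : ∀ x ∈ S, IsBox (Q x) := by
    intro x hx
    choose b B hB hb using fun g : H => hPiso g _ (p g x hx).2
    have hQeq : Q x = ⋂ t : (H × H) ⊕ H, Sum.elim (fun t : H × H =>
        (fun y => b t.1 + (B t.1).mulVec y) ⁻¹' (p t.2 ((t.1 : Equiv.Perm _) x) (hgS t.1 hx)).1)
        (fun g => (p g x hx).1) t := by
      ext y
      simp only [Set.mem_iInter, Sum.forall, Sum.elim_inl, Sum.elim_inr, Prod.forall,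
        Set.mem_preimage]
      constructor
      · intro hy
        refine ⟨fun g h => ?_, fun g => hQsub g x hx hy⟩
        rw [← hb g y (hQsub g x hx hy)]
        exact (hmem x hx y).mp hy g h
      · rintro ⟨h1, h2⟩
        refine (hmem x hx y).mpr fun g h => ?_
        rw [hb g y (h2 g)]
        exact h1 g h
    rw [hQeq]
    refine isBox_iInter ?_
    rintro (⟨g, h⟩ | g)
    · exact (hPorth h _ (p h _ (hgS g hx)).2).preimage (b g) (hB g)
    · exact hPorth g _ (p g x hx).2
  have hsig : ∀ (g : H) x y, y ∈ Q x → (g : Equiv.Perm _) y ∈ Q ((g : Equiv.Perm _) x) := by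
    intro g x y hy
    ext ⟨k, h, L⟩
    have h1 := Set.ext_iff.mp (show sig y = sig x from hy) (k * g, ⟨h, L⟩)
    exact h1
  have himage : ∀ (g : H) x, (g : Equiv.Perm _) '' Q x = Q ((g : Equiv.Perm _) x) := by
    intro g x
    refine Set.Subset.antisymm (Set.image_subset_iff.mpr fun y hy => hsig g x y hy) fun y hy => ?_
    refine ⟨(g⁻¹ : H).1 y, ?_, by simp⟩
    simpa using hsig g⁻¹ _ y hy
  refine ⟨⋃₀ (maxOrthants '' (Q '' S)), ?_, ?_, ?_, ?_, ?_⟩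
  · refine Set.Finite.sUnion (Set.Finite.image _ ?_) ?_
    · refine (Set.finite_range fun s => {y | sig y = s}).subset ?_
      rintro _ ⟨x, -, rfl⟩
      exact ⟨sig x, rfl⟩
    · rintro _ ⟨_, ⟨x, hx, rfl⟩, rfl⟩
      exact (hQbox x hx).maxOrthants_partition.1
  · rintro L ⟨_, ⟨_, ⟨x, hx, rfl⟩, rfl⟩, hL⟩
    exact hL.1.1
  · rintro L ⟨_, ⟨_, ⟨x, hx, rfl⟩, rfl⟩, hL⟩ L' ⟨_, ⟨_, ⟨x', hx', rfl⟩, rfl⟩, hL'⟩ hne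
    refine Set.disjoint_left.mpr fun z hz hz' => hne ?_
    have hQQ : Q x = Q x' := by
      have h1 : sig z = sig x := hL.1.2 hz
      have h2 : sig z = sig x' := hL'.1.2 hz'
      simp only [Q, ← h1, ← h2]
    rw [← hQQ] at hL'
    exact (hQbox x hx).maxOrthants_partition.2.2 L hL L' hL' z hz hz'
  · refine Set.Subset.antisymm ?_ fun x hx => ?_
    · rintro z ⟨L, ⟨_, ⟨_, ⟨x, hx, rfl⟩, rfl⟩, hL⟩, hz⟩
      exact hQS x hx (hL.1.2 hz)
    · obtain ⟨L, hL, hxL⟩ := (hQbox x hx).maxOrthants_partition.2.1 x rfl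
      exact ⟨L, ⟨_, ⟨_, ⟨x, hx, rfl⟩, rfl⟩, hL⟩, hxL⟩
  · rintro g hg L ⟨_, ⟨_, ⟨x, hx, rfl⟩, rfl⟩, hL⟩
    have hiso := hQiso ⟨g, hg⟩ x hx
    refine ⟨hiso.mono hL.1.2, maxOrthants (Q (g x)), ⟨_, ⟨g x, hgS ⟨g, hg⟩ hx, rfl⟩, rfl⟩, ?_⟩
    have him : g '' Q x = Q (g x) := himage ⟨g, hg⟩ x
    rw [← him]
    refine image_mem_maxOrthants hiso ?_ hL
    rw [him]
    exact hQiso (⟨g, hg⟩⁻¹ : H) (g x) (hgS ⟨g, hg⟩ hx)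

/-- A group of permutations supported on finitely many orthants, acting by isometries on and
between them, is finite. -/
lemma finite_of_isometric_on_orthants {N : ℕ} {H : Subgroup (Equiv.Perm (Fin N → ℤ))}
    {Λ : Set (Set (Fin N → ℤ))} (hfin : Λ.Finite) (horth : ∀ L ∈ Λ, IsOrthant L)
    (hfix : ∀ g ∈ H, ∀ x ∉ ⋃₀ Λ, g x = x)
    (hiso : ∀ g ∈ H, ∀ L ∈ Λ, IsometricOn g L ∧ g '' L ∈ Λ) : Finite H := by
  have : Finite Λ := hfin.to_subtype
  have : Finite {A : Matrix (Fin N) (Fin N) ℤ // IsOrthMat A} := (finite_isOrthMat N).to_subtype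
  choose a A hA ha using fun (g : H) (L : Λ) => (hiso g g.2 L L.2).1
  let F : H → Λ → Λ × {A : Matrix (Fin N) (Fin N) ℤ // IsOrthMat A} := fun g L =>
    (⟨(g : Equiv.Perm _) '' L, (hiso g g.2 L L.2).2⟩, ⟨A g L, hA g L⟩)
  refine Finite.of_injective F fun g h hgh => Subtype.ext (Equiv.ext fun x => ?_)
  by_cases hx : x ∈ ⋃₀ Λ
  · obtain ⟨L, hL, hxL⟩ := hx
    have hFL := congrFun hgh ⟨L, hL⟩
    have himage : (g : Equiv.Perm _) '' L = (h : Equiv.Perm _) '' L :=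
      congrArg Subtype.val (congrArg Prod.fst hFL)
    have hAA : A g ⟨L, hL⟩ = A h ⟨L, hL⟩ := congrArg Subtype.val (congrArg Prod.snd hFL)
    have haa : a g ⟨L, hL⟩ = a h ⟨L, hL⟩ := by
      refine (horth _ (hiso h h.2 L hL).2).eq_of_image_eq (T := (A g ⟨L, hL⟩).mulVec '' L) ?_ ?_
      · rw [Set.image_image, ← himage]
        exact (Set.image_congr (ha g ⟨L, hL⟩)).symm
      · rw [Set.image_image, hAA]
        exact (Set.image_congr (ha h ⟨L, hL⟩)).symm
    rw [ha g ⟨L, hL⟩ x hxL, ha h ⟨L, hL⟩ x hxL, hAA, haa]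
  · rw [hfix g g.2 x hx, hfix h h.2 x hx]

/-- a subgroup of `pei(S)` is finite iff its support is a finite disjoint
union of orthants on which it acts faithfully by isometries on and between the members. -/
theorem stmt14 {N : ℕ} (S : Set (Fin N → ℤ)) (hS : IsOrthohedral S)
    (H : Subgroup (Equiv.Perm (Fin N → ℤ))) (hH : ∀ g ∈ H, IsPeiPerm S g) :
    Finite ↥H ↔ ∃ Λ : Set (Set (Fin N → ℤ)), Λ.Finite ∧ (∀ L ∈ Λ, IsOrthant L) ∧
      Λ.PairwiseDisjoint id ∧ ⋃₀ Λ ⊆ S ∧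
      (∀ g ∈ H, ∀ x ∉ ⋃₀ Λ, g x = x) ∧
      (∀ g ∈ H, ∀ L ∈ Λ, IsometricOn (⇑g) L ∧ ∃ L' ∈ Λ, ⇑g '' L = L') ∧
      (∀ g ∈ H, (∀ x ∈ ⋃₀ Λ, g x = x) → g = 1) := by
  constructor
  · intro hfin
    obtain ⟨Λ, hΛ, horth, hdisj, hunion, hiso⟩ := exists_invariant_partition hH
    refine ⟨Λ, hΛ, horth, hdisj, hunion.subset, ?_, ?_, ?_⟩
    · rw [hunion]
      exact fun g hg => (hH g hg).2
    · exact fun g hg L hL => ⟨(hiso g hg L hL).1, _, (hiso g hg L hL).2, rfl⟩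
    · rw [hunion]
      intro g hg hgS
      ext1 x
      by_cases hx : x ∈ S
      exacts [hgS x hx, (hH g hg).2 x hx]
  · rintro ⟨Λ, hΛ, horth, -, -, hfix, hiso, -⟩
    refine finite_of_isometric_on_orthants hΛ horth hfix fun g hg L hL => ?_
    obtain ⟨h, L', hL', heq⟩ := hiso g hg L hL
    exact ⟨h, heq ▸ hL'⟩

end PeiPaper
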